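/- If a > 0 and b ≠ 0, then the matrix M_{a,b} has four pairwise distinct complex eigenvalues; equivalently, for any c ∈ ℂ with c² = 1 − b² − 4a − 2ib, the four numbers ½(1 − ib − c), ½(1 − ib + c), ½(1 + ib − c̄), ½(1 + ib + c̄) are pairwise distinct. -/

import Mathlib

open Matrix Polynomial

/-- The matrix `M_{a,b}` of the quadratic Kramers-Fokker-Planck operator with magnetic field. -/
noncomputable def Mab (a b : ℝ) : Matrix (Fin 4) (Fin 4) ℝ :=
  !![1, b, Real.sqrt a, 0;
     -b, 1, 0, Real.sqrt a;
     -Real.sqrt a, 0, 0, 0;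
     0, -Real.sqrt a, 0, 0]

/-- `M_{a,b}` viewed as a complex matrix. -/
noncomputable def MabC (a b : ℝ) : Matrix (Fin 4) (Fin 4) ℂ :=
  (Mab a b).map Complex.ofReal

open Complex in
theorem det_algebraMap_sub_MabC (a b : ℝ) (ha : 0 < a) (z : ℂ) :
    (algebraMap ℂ (Matrix (Fin 4) (Fin 4) ℂ) z - MabC a b).det =
      (z ^ 2 - (1 - I * b) * z + a) * (z ^ 2 - (1 + I * b) * z + a) := by
  have hs : ((Real.sqrt a : ℝ) : ℂ) ^ 2 = a := by
    exact_mod_cast Real.sq_sqrt ha.le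
  rw [← hs]
  simp [MabC, Mab, Matrix.algebraMap_matrix_apply, Matrix.det_succ_row_zero, Fin.sum_univ_succ,
    Fin.succAbove]
  linear_combination ((b : ℂ) ^ 2 * z ^ 2) * I_sq

open Complex in
theorem mem_spectrum_MabC_iff (a b : ℝ) (ha : 0 < a) (z : ℂ) :
    z ∈ spectrum ℂ (MabC a b) ↔
      z ^ 2 - (1 - I * b) * z + a = 0 ∨ z ^ 2 - (1 + I * b) * z + a = 0 := by
  rw [spectrum.mem_iff, Matrix.isUnit_iff_isUnit_det, det_algebraMap_sub_MabC a b ha,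
    isUnit_iff_ne_zero, not_not, mul_eq_zero]

theorem quadratic_eq_zero_iff_of_sq_eq {s p c : ℂ} (hc : c ^ 2 = s ^ 2 - 4 * p) (z : ℂ) :
    z ^ 2 - s * z + p = 0 ↔ z = (s - c) / 2 ∨ z = (s + c) / 2 := by
  rw [← sub_eq_zero (a := z), ← sub_eq_zero (a := z) (b := (s + c) / 2), ← mul_eq_zero]
  have : (z - (s - c) / 2) * (z - (s + c) / 2) = z ^ 2 - s * z + p := by
    linear_combination (-1 / 4 : ℂ) * hc
  rw [this]

open Complex in
theorem quadratics_no_common_root {a b : ℝ} (ha : 0 < a) (hb : b ≠ 0) {z : ℂ}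
    (h₁ : z ^ 2 - (1 - I * b) * z + a = 0) (h₂ : z ^ 2 - (1 + I * b) * z + a = 0) : False := by
  have hz : (2 * I * b) * z = 0 := by linear_combination h₁ - h₂
  have hz : z = 0 := by simpa [hb] using hz
  subst hz
  simp [ha.ne'] at h₁

section

variable {a b : ℝ} {c : ℂ}

open Complex

theorem sq_eq_discrim
    (hc : c ^ 2 = 1 - (b : ℂ) ^ 2 - 4 * (a : ℂ) - 2 * I * (b : ℂ)) :
    c ^ 2 = (1 - I * b) ^ 2 - 4 * a := by
  linear_combination hc - (b : ℂ) ^ 2 * I_sq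

theorem conj_sq_eq_discrim
    (hc : c ^ 2 = 1 - (b : ℂ) ^ 2 - 4 * (a : ℂ) - 2 * I * (b : ℂ)) :
    (starRingEnd ℂ) c ^ 2 = (1 + I * b) ^ 2 - 4 * a := by
  have h := congrArg (starRingEnd ℂ) (sq_eq_discrim hc)
  simpa [map_ofNat] using h

theorem ne_zero_of_sq_eq (hb : b ≠ 0)
    (hc : c ^ 2 = 1 - (b : ℂ) ^ 2 - 4 * (a : ℂ) - 2 * I * (b : ℂ)) : c ≠ 0 := by
  rintro rfl
  have h := congrArg im hc
  simp [← ofReal_pow, hb] at h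

theorem eigenvalues_injective (ha : 0 < a) (hb : b ≠ 0)
    (hc : c ^ 2 = 1 - (b : ℂ) ^ 2 - 4 * (a : ℂ) - 2 * I * (b : ℂ)) :
    Function.Injective
      (![(1 - I * (b : ℂ) - c) / 2, (1 - I * (b : ℂ) + c) / 2,
         (1 + I * (b : ℂ) - (starRingEnd ℂ) c) / 2,
         (1 + I * (b : ℂ) + (starRingEnd ℂ) c) / 2] : Fin 4 → ℂ) := by
  have hc0 := ne_zero_of_sq_eq hb hc
  have hd0 : (starRingEnd ℂ) c ≠ 0 := by simpa using hc0
  have key : ∀ s d : ℂ, d ≠ 0 → (s - d) / 2 ≠ (s + d) / 2 := fun s d hd h =>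
    hd (by linear_combination -h)
  have hp := quadratic_eq_zero_iff_of_sq_eq (sq_eq_discrim hc)
  have hq := quadratic_eq_zero_iff_of_sq_eq (conj_sq_eq_discrim hc)
  have cross : ∀ z w : ℂ, z = (1 - I * b - c) / 2 ∨ z = (1 - I * b + c) / 2 →
      w = (1 + I * b - (starRingEnd ℂ) c) / 2 ∨ w = (1 + I * b + (starRingEnd ℂ) c) / 2 →
      z ≠ w := by
    rintro z _ hz hw rfl
    exact quadratics_no_common_root ha hb ((hp z).2 hz) ((hq z).2 hw)
  have h01 := key (1 - I * b) c hc0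
  have h23 := key (1 + I * b) _ hd0
  have h02 := cross _ _ (.inl rfl) (.inl rfl)
  have h03 := cross _ _ (.inl rfl) (.inr rfl)
  have h12 := cross _ _ (.inr rfl) (.inl rfl)
  have h13 := cross _ _ (.inr rfl) (.inr rfl)
  intro i j hij
  fin_cases i <;> fin_cases j <;> first
    | rfl
    | exact absurd hij ‹_›
    | exact absurd hij.symm ‹_›

theorem spectrum_MabC_eq_range (ha : 0 < a)
    (hc : c ^ 2 = 1 - (b : ℂ) ^ 2 - 4 * (a : ℂ) - 2 * I * (b : ℂ)) :
    spectrum ℂ (MabC a b) = Set.range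
      (![(1 - I * (b : ℂ) - c) / 2, (1 - I * (b : ℂ) + c) / 2,
         (1 + I * (b : ℂ) - (starRingEnd ℂ) c) / 2,
         (1 + I * (b : ℂ) + (starRingEnd ℂ) c) / 2] : Fin 4 → ℂ) := by
  ext z
  rw [mem_spectrum_MabC_iff a b ha, quadratic_eq_zero_iff_of_sq_eq (sq_eq_discrim hc),
    quadratic_eq_zero_iff_of_sq_eq (conj_sq_eq_discrim hc)]
  simp
  tauto

end

/-- If `a > 0` and `b ≠ 0`, then `M_{a,b}` has four pairwise distinct complex eigenvalues;
equivalently, for any `c` with `c² = 1 - b² - 4a - 2ib`, the four numbers `½(1-ib-c)`,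
`½(1-ib+c)`, `½(1+ib-c̄)`, `½(1+ib+c̄)` are pairwise distinct. -/
theorem stmt_4 (a b : ℝ) (ha : 0 < a) (hb : b ≠ 0) :
    (spectrum ℂ (MabC a b)).ncard = 4 ∧
    ∀ c : ℂ, c ^ 2 = 1 - (b : ℂ) ^ 2 - 4 * (a : ℂ) - 2 * Complex.I * (b : ℂ) →
      Function.Injective
        (![(1 - Complex.I * (b : ℂ) - c) / 2, (1 - Complex.I * (b : ℂ) + c) / 2,
           (1 + Complex.I * (b : ℂ) - (starRingEnd ℂ) c) / 2,
           (1 + Complex.I * (b : ℂ) + (starRingEnd ℂ) c) / 2] : Fin 4 → ℂ) := by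
  refine ⟨?_, fun c hc => eigenvalues_injective ha hb hc⟩
  obtain ⟨c, hc⟩ := IsAlgClosed.exists_pow_nat_eq
    (1 - (b : ℂ) ^ 2 - 4 * (a : ℂ) - 2 * Complex.I * (b : ℂ)) two_pos
  rw [spectrum_MabC_eq_range ha hc, ← Set.image_univ,
    Set.ncard_image_of_injective _ (eigenvalues_injective ha hb hc)]
  simp [Set.ncard_univ]
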